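/- arXiv:1901.00214 — 5 statements merged into one kernel-verified Lean document; each statement's English description precedes it below -/
import Mathlib

section
/- Let the dataset contain at least K distinct points, the communication graph be connected, and the step size satisfy 0 < α < d_min/((1/ρ)N* + λ_M(L)). Let x̆ be a limit point of the sequence (x_t) generated by the NK-means algorithm and let (x_{t_s})_{s≥0} be a subsequence with x_{t_s} → x̆ as s → ∞. Then there exists s' such that C_{t_s + 1} ∈ Ū_x̆ for all s ≥ s'. -/
open scoped BigOperators

noncomputable section

/-! ### Basic (centralized) K-means notions -/

/-- The dataset `D` contains at least `K` distinct points. -/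
def HasKDistinct {p : ℕ} (K : ℕ) (D : Multiset (EuclideanSpace ℝ (Fin p))) : Prop :=
  ∃ S : Finset (EuclideanSpace ℝ (Fin p)), S.card = K ∧ ∀ y ∈ S, y ∈ D

/-- The K-means clustering cost `F(x) = ∑_{y ∈ D} min_k ‖y - x^k‖²`. -/
def kmeansF {p : ℕ} (K : ℕ) (D : Multiset (EuclideanSpace ℝ (Fin p)))
    (x : Fin K → EuclideanSpace ℝ (Fin p)) : ℝ :=
  (D.map fun y => ⨅ k : Fin K, ‖y - x k‖ ^ 2).sum

/-- `P` is a partition of the multiset `D` into `K` (possibly empty) cells. -/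
def IsKPartition {p K : ℕ} (D : Multiset (EuclideanSpace ℝ (Fin p)))
    (P : Fin K → Multiset (EuclideanSpace ℝ (Fin p))) : Prop :=
  ∑ k, P k = D

/-- The distortion cost `H(x, P) = ∑_k ∑_{y ∈ P^k} ‖y - x^k‖²`. -/
def costH {p K : ℕ} (x : Fin K → EuclideanSpace ℝ (Fin p))
    (P : Fin K → Multiset (EuclideanSpace ℝ (Fin p))) : ℝ :=
  ∑ k, ((P k).map fun y => ‖y - x k‖ ^ 2).sum

/-- `(x, P)` is a Lloyd's minimum for the dataset `D`. -/
def IsLloydMin {p K : ℕ} (D : Multiset (EuclideanSpace ℝ (Fin p)))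
    (x : Fin K → EuclideanSpace ℝ (Fin p))
    (P : Fin K → Multiset (EuclideanSpace ℝ (Fin p))) : Prop :=
  IsKPartition D P ∧
    (∀ Q, IsKPartition D Q → costH x P ≤ costH x Q) ∧
    (∀ x', costH x P ≤ costH x' P)

/-- The set `Z` of Lloyd's minima (cluster-center tuples). -/
def LloydZ {p : ℕ} (K : ℕ) (D : Multiset (EuclideanSpace ℝ (Fin p))) :
    Set (Fin K → EuclideanSpace ℝ (Fin p)) :=
  {x | ∃ P, IsLloydMin D x P}

/-- The set `Z̄` of Lloyd's minima whose centers lie in the (closed) convex hull of `D`. -/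
def LloydZbar {p : ℕ} (K : ℕ) (D : Multiset (EuclideanSpace ℝ (Fin p))) :
    Set (Fin K → EuclideanSpace ℝ (Fin p)) :=
  {x ∈ LloydZ K D | ∀ k, x k ∈ convexHull ℝ {y | y ∈ D}}

/-- The set `Z_g` of global minimizers of the K-means cost `F`. -/
def kmeansZg {p : ℕ} (K : ℕ) (D : Multiset (EuclideanSpace ℝ (Fin p))) :
    Set (Fin K → EuclideanSpace ℝ (Fin p)) :=
  {x | ∀ x', kmeansF K D x ≤ kmeansF K D x'}

/-- The global minimum value `F*` of the K-means cost. -/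
def Fstar {p : ℕ} (K : ℕ) (D : Multiset (EuclideanSpace ℝ (Fin p))) : ℝ :=
  sInf (Set.range (kmeansF K D))

/-- `R₀ = max{‖v‖ : v ∈ closed convex hull of D}`. -/
def R0 {p : ℕ} (D : Multiset (EuclideanSpace ℝ (Fin p))) : ℝ :=
  sSup ((fun v => ‖v‖) '' convexHull ℝ {y | y ∈ D})

/-! ### Multi-agent notions -/

section Distributed

variable {p K M : ℕ}

/-- The multi-agent cost `J^ρ(x, C)`; each undirected edge is counted once in the
agreement term. -/
def costJ (ρ : ℝ) (G : SimpleGraph (Fin M)) [DecidableRel G.Adj]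
    (x : Fin M → Fin K → EuclideanSpace ℝ (Fin p))
    (C : Fin M → Fin K → Multiset (EuclideanSpace ℝ (Fin p))) : ℝ :=
  (1 / ρ) * ∑ m, ∑ k, ((C m k).map fun y => ‖y - x m k‖ ^ 2).sum +
    (1 / 2) * ∑ m, ∑ l ∈ G.neighborFinset m, ∑ k, ‖x m k - x l k‖ ^ 2

/-- The multi-agent cost `Q^ρ(x)`. -/
def costQ (ρ : ℝ) (G : SimpleGraph (Fin M)) [DecidableRel G.Adj]
    (Dm : Fin M → Multiset (EuclideanSpace ℝ (Fin p)))
    (x : Fin M → Fin K → EuclideanSpace ℝ (Fin p)) : ℝ :=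
  (1 / ρ) * ∑ m, ((Dm m).map fun y => ⨅ k : Fin K, ‖y - x m k‖ ^ 2).sum +
    (1 / 2) * ∑ m, ∑ l ∈ G.neighborFinset m, ∑ k, ‖x m k - x l k‖ ^ 2

/-- The set of global minimizers `M^ρ_g` of `Q^ρ`. -/
def globQ (ρ : ℝ) (G : SimpleGraph (Fin M)) [DecidableRel G.Adj]
    (Dm : Fin M → Multiset (EuclideanSpace ℝ (Fin p))) (K : ℕ) :
    Set (Fin M → Fin K → EuclideanSpace ℝ (Fin p)) :=
  {x | ∀ x' : Fin M → Fin K → EuclideanSpace ℝ (Fin p), costQ ρ G Dm x ≤ costQ ρ G Dm x'}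

/-- `C ∈ U_x` : `C` is an admissible (Voronoi / nearest-center) clustering for `x`. -/
def InVoronoi (Dm : Fin M → Multiset (EuclideanSpace ℝ (Fin p)))
    (x : Fin M → Fin K → EuclideanSpace ℝ (Fin p))
    (C : Fin M → Fin K → Multiset (EuclideanSpace ℝ (Fin p))) : Prop :=
  (∀ m, IsKPartition (Dm m) (C m)) ∧
    ∀ m k y, y ∈ C m k → ∀ k', ‖y - x m k‖ ≤ ‖y - x m k'‖

/-- The fixed-point (stationarity) equations
`((1/ρ)|C_m^k| + |Ω_m|) x_m^k = (1/ρ) ∑_{y ∈ C_m^k} y + ∑_{l ∈ Ω_m} x_l^k`. -/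
def IsFixedCenters (ρ : ℝ) (G : SimpleGraph (Fin M)) [DecidableRel G.Adj]
    (x : Fin M → Fin K → EuclideanSpace ℝ (Fin p))
    (C : Fin M → Fin K → Multiset (EuclideanSpace ℝ (Fin p))) : Prop :=
  ∀ m k, ((1 / ρ) * ((C m k).card : ℝ) + (G.degree m : ℝ)) • x m k =
      (1 / ρ) • (C m k).sum + ∑ l ∈ G.neighborFinset m, x l k

/-- `(x, C)` is a generalized Lloyd's minimum of `J^ρ`. -/
def IsGenLloydMin (ρ : ℝ) (G : SimpleGraph (Fin M)) [DecidableRel G.Adj]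
    (Dm : Fin M → Multiset (EuclideanSpace ℝ (Fin p)))
    (x : Fin M → Fin K → EuclideanSpace ℝ (Fin p))
    (C : Fin M → Fin K → Multiset (EuclideanSpace ℝ (Fin p))) : Prop :=
  InVoronoi Dm x C ∧ IsFixedCenters ρ G x C

/-- The set `M^ρ` of generalized Lloyd's minima (centers part). -/
def genM (ρ : ℝ) (G : SimpleGraph (Fin M)) [DecidableRel G.Adj]
    (Dm : Fin M → Multiset (EuclideanSpace ℝ (Fin p))) (K : ℕ) :
    Set (Fin M → Fin K → EuclideanSpace ℝ (Fin p)) :=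
  {x | ∃ C, IsGenLloydMin ρ G Dm x C}

/-- The set `M̄^ρ` of generalized Lloyd's minima with all centers in the (closed)
convex hull of the collective dataset `D`. -/
def genMbar (ρ : ℝ) (G : SimpleGraph (Fin M)) [DecidableRel G.Adj]
    (Dm : Fin M → Multiset (EuclideanSpace ℝ (Fin p)))
    (D : Multiset (EuclideanSpace ℝ (Fin p))) (K : ℕ) :
    Set (Fin M → Fin K → EuclideanSpace ℝ (Fin p)) :=
  {x ∈ genM ρ G Dm K | ∀ m k, x m k ∈ convexHull ℝ {y | y ∈ D}}

/-- The update target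
`μ_m^k = ((1/ρ) ∑_{y ∈ C_m^k} y + ∑_{l ∈ Ω_m} x_l^k) / ((1/ρ)|C_m^k| + |Ω_m|)`. -/
def muVec (ρ : ℝ) (G : SimpleGraph (Fin M)) [DecidableRel G.Adj]
    (x : Fin M → Fin K → EuclideanSpace ℝ (Fin p))
    (C : Fin M → Fin K → Multiset (EuclideanSpace ℝ (Fin p)))
    (m : Fin M) (k : Fin K) : EuclideanSpace ℝ (Fin p) :=
  ((1 / ρ) * ((C m k).card : ℝ) + (G.degree m : ℝ))⁻¹ •
    ((1 / ρ) • (C m k).sum + ∑ l ∈ G.neighborFinset m, x l k)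

/-- `(x_t, C_t)` is a trajectory of the NK-means algorithm with parameters `ρ, α`. -/
def NKMeansSeq (ρ α : ℝ) (G : SimpleGraph (Fin M)) [DecidableRel G.Adj]
    (Dm : Fin M → Multiset (EuclideanSpace ℝ (Fin p)))
    (x : ℕ → Fin M → Fin K → EuclideanSpace ℝ (Fin p))
    (C : ℕ → Fin M → Fin K → Multiset (EuclideanSpace ℝ (Fin p))) : Prop :=
  (∀ m, IsKPartition (Dm m) (C 0 m)) ∧
    ∀ t, (∀ m, IsKPartition (Dm m) (C (t + 1) m)) ∧
      (∀ m k y, y ∈ C (t + 1) m k → ∀ k', ‖y - x t m k‖ ≤ ‖y - x t m k'‖) ∧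
      ∀ m k, x (t + 1) m k = x t m k - α • (x t m k - muVec ρ G (x t) (C (t + 1)) m k)

/-- The minimum vertex degree `d_min` of the communication graph. -/
def minDeg (G : SimpleGraph (Fin M)) [DecidableRel G.Adj] : ℕ :=
  sInf (Set.range fun m : Fin M => G.degree m)

/-- The largest eigenvalue `λ_M(L)` of the graph Laplacian. -/
def lapLamMax (G : SimpleGraph (Fin M)) [DecidableRel G.Adj] : ℝ :=
  sSup (spectrum ℝ (G.lapMatrix ℝ))

/-- The second-smallest eigenvalue `λ₂(L)` of the graph Laplacian (for a connected
graph, the smallest nonzero eigenvalue). -/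
def lapLam2 (G : SimpleGraph (Fin M)) [DecidableRel G.Adj] : ℝ :=
  sInf {μ : ℝ | μ ∈ spectrum ℝ (G.lapMatrix ℝ) ∧ μ ≠ 0}

/-- `N* = max_m |D_m|`. -/
def Nstar (Dm : Fin M → Multiset (EuclideanSpace ℝ (Fin p))) : ℕ :=
  Finset.univ.sup fun m => (Dm m).card

/-- The step-size condition `0 < α < d_min / ((1/ρ) N* + λ_M(L))`. -/
def StepOK (ρ α : ℝ) (G : SimpleGraph (Fin M)) [DecidableRel G.Adj]
    (Dm : Fin M → Multiset (EuclideanSpace ℝ (Fin p))) : Prop :=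
  0 < α ∧ α * ((1 / ρ) * (Nstar Dm : ℝ) + lapLamMax G) < (minDeg G : ℝ)

/-- The constant `c(α) = 2α(d_min − α((1/ρ)N* + λ_M(L)))`. -/
def cAlpha (ρ α : ℝ) (G : SimpleGraph (Fin M)) [DecidableRel G.Adj]
    (Dm : Fin M → Multiset (EuclideanSpace ℝ (Fin p))) : ℝ :=
  2 * α * ((minDeg G : ℝ) - α * ((1 / ρ) * (Nstar Dm : ℝ) + lapLamMax G))

end Distributed

/-! ### The Laplacian quadratic form -/

theorem lapLamMax_nonneg {M : ℕ} (G : SimpleGraph (Fin M)) [DecidableRel G.Adj] :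
    0 ≤ lapLamMax G :=
  Real.sSup_nonneg fun _ hμ =>
    (Matrix.posSemidef_iff_isHermitian_and_spectrum_nonneg.1
      (SimpleGraph.posSemidef_lapMatrix ℝ G)).2 hμ

theorem Matrix.IsHermitian.dotProduct_mulVec_le_sSup_spectrum {n : Type*} [Fintype n]
    [DecidableEq n] {A : Matrix n n ℝ} (hA : A.IsHermitian) (u : n → ℝ) :
    u ⬝ᵥ A.mulVec u ≤ sSup (spectrum ℝ A) * (u ⬝ᵥ u) := by
  have hfin : (spectrum ℝ A).Finite := Matrix.finite_real_spectrum
  have hpsd : (algebraMap ℝ (Matrix n n ℝ) (sSup (spectrum ℝ A)) - A).PosSemidef := by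
    refine Matrix.posSemidef_iff_isHermitian_and_spectrum_nonneg.2 ⟨?_, ?_⟩
    · refine Matrix.IsHermitian.sub ?_ hA
      rw [Matrix.algebraMap_eq_diagonal]
      exact Matrix.isHermitian_diagonal _
    · rw [← spectrum.singleton_sub_eq]
      rintro _ ⟨a, rfl, b, hb, rfl⟩
      exact sub_nonneg.2 (le_csSup hfin.bddAbove hb)
  have h := hpsd.dotProduct_mulVec_nonneg u
  rw [star_trivial, Matrix.sub_mulVec, dotProduct_sub, Algebra.algebraMap_eq_smul_one,
    Matrix.smul_mulVec, Matrix.one_mulVec, dotProduct_smul, smul_eq_mul] at h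
  linarith

theorem sum_neighbor_sq_le {M : ℕ} (G : SimpleGraph (Fin M)) [DecidableRel G.Adj]
    (u : Fin M → ℝ) :
    (1 / 2) * ∑ m, ∑ l ∈ G.neighborFinset m, (u m - u l) ^ 2 ≤
      lapLamMax G * ∑ m, u m ^ 2 := by
  have h := (SimpleGraph.isHermitian_lapMatrix ℝ G).dotProduct_mulVec_le_sSup_spectrum u
  rw [← Matrix.toLinearMap₂'_apply', SimpleGraph.lapMatrix_toLinearMap₂'] at h
  simp only [SimpleGraph.neighborFinset_eq_filter, Finset.sum_filter]
  simp only [dotProduct, ← pow_two] at h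
  unfold lapLamMax
  linarith

theorem sum_neighbor_norm_sq_le {p M : ℕ} (G : SimpleGraph (Fin M)) [DecidableRel G.Adj]
    (δ : Fin M → EuclideanSpace ℝ (Fin p)) :
    (1 / 2) * ∑ m, ∑ l ∈ G.neighborFinset m, ‖δ m - δ l‖ ^ 2 ≤
      lapLamMax G * ∑ m, ‖δ m‖ ^ 2 := by
  have h := Finset.sum_le_sum fun i (_ : i ∈ Finset.univ) =>
    sum_neighbor_sq_le G fun m => δ m i
  simp only [EuclideanSpace.real_norm_sq_eq, PiLp.sub_apply]
  rw [← Finset.mul_sum, ← Finset.mul_sum, Finset.sum_comm, Finset.sum_comm (s := Finset.univ)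
    (t := Finset.univ) (f := fun i m => δ m i ^ 2)] at h
  refine le_trans (le_of_eq ?_) h
  congr 1
  exact Finset.sum_congr rfl fun m _ => Finset.sum_comm

/-! ### Expansion of the cost -/

section Expansion

variable {E : Type*} [NormedAddCommGroup E] [InnerProductSpace ℝ E]

theorem sum_map_norm_sub_add_sq (P : Multiset E) (a d : E) :
    (P.map fun y => ‖y - (a + d)‖ ^ 2).sum =
      (P.map fun y => ‖y - a‖ ^ 2).sum +
        2 * inner ℝ ((P.card : ℝ) • a - P.sum) d + P.card * ‖d‖ ^ 2 := by
  induction P using Multiset.induction_on with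
  | empty => simp
  | cons y P ih =>
    rw [Multiset.map_cons, Multiset.sum_cons, ih, Multiset.map_cons, Multiset.sum_cons,
      Multiset.sum_cons, Multiset.card_cons, ← sub_sub, norm_sub_sq_real (y - a) d]
    simp only [inner_sub_left, inner_add_left, inner_smul_left, Nat.cast_add, Nat.cast_one,
      RCLike.conj_to_real]
    ring

theorem sum_neighbor_norm_sub_add_sq {M : ℕ} (G : SimpleGraph (Fin M)) [DecidableRel G.Adj]
    (a d : Fin M → E) :
    (1 / 2) * ∑ m, ∑ l ∈ G.neighborFinset m, ‖a m + d m - (a l + d l)‖ ^ 2 =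
      (1 / 2) * ∑ m, ∑ l ∈ G.neighborFinset m, ‖a m - a l‖ ^ 2 +
        2 * ∑ m, inner ℝ ((G.degree m : ℝ) • a m - ∑ l ∈ G.neighborFinset m, a l) (d m) +
        (1 / 2) * ∑ m, ∑ l ∈ G.neighborFinset m, ‖d m - d l‖ ^ 2 := by
  have hsymm : ∑ m, ∑ l ∈ G.neighborFinset m, inner ℝ (a m - a l) (d l) =
      -∑ m, ∑ l ∈ G.neighborFinset m, inner ℝ (a m - a l) (d m) := by
    simp only [SimpleGraph.neighborFinset_eq_filter, Finset.sum_filter]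
    rw [Finset.sum_comm, ← Finset.sum_neg_distrib]
    refine Finset.sum_congr rfl fun m _ => ?_
    rw [← Finset.sum_neg_distrib]
    refine Finset.sum_congr rfl fun l _ => ?_
    simp only [G.adj_comm l m]
    split_ifs
    · rw [← inner_neg_left, neg_sub]
    · simp
  have hgrad : ∀ m, inner ℝ ((G.degree m : ℝ) • a m - ∑ l ∈ G.neighborFinset m, a l) (d m) =
      ∑ l ∈ G.neighborFinset m, inner ℝ (a m - a l) (d m) := fun m => by
    rw [← sum_inner, Finset.sum_sub_distrib, Finset.sum_const,
      SimpleGraph.card_neighborFinset_eq_degree, Nat.cast_smul_eq_nsmul]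
  have hpt : ∀ m l, ‖a m + d m - (a l + d l)‖ ^ 2 =
      ‖a m - a l‖ ^ 2 + 2 * inner ℝ (a m - a l) (d m) - 2 * inner ℝ (a m - a l) (d l) +
        ‖d m - d l‖ ^ 2 := fun m l => by
    rw [add_sub_add_comm, norm_add_sq_real, inner_sub_right]
    ring
  simp only [hpt, hgrad, Finset.sum_add_distrib, Finset.sum_sub_distrib, ← Finset.mul_sum, hsymm]
  ring

end Expansion

section Descent

variable {p K M : ℕ}

/-- Half the gradient of `costJ` in the center `x_m^k`. -/
def halfGrad (ρ : ℝ) (G : SimpleGraph (Fin M)) [DecidableRel G.Adj]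
    (x : Fin M → Fin K → EuclideanSpace ℝ (Fin p)) (P : Multiset (EuclideanSpace ℝ (Fin p)))
    (m : Fin M) (k : Fin K) : EuclideanSpace ℝ (Fin p) :=
  ((1 / ρ) * (P.card : ℝ) + (G.degree m : ℝ)) • x m k -
    ((1 / ρ) • P.sum + ∑ l ∈ G.neighborFinset m, x l k)

theorem costJ_add (ρ : ℝ) (G : SimpleGraph (Fin M)) [DecidableRel G.Adj]
    (x δ : Fin M → Fin K → EuclideanSpace ℝ (Fin p))
    (C : Fin M → Fin K → Multiset (EuclideanSpace ℝ (Fin p))) :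
    costJ ρ G (x + δ) C = costJ ρ G x C +
      ∑ k, ∑ m, (2 * inner ℝ (halfGrad ρ G x (C m k) m k) (δ m k) +
        (1 / ρ) * (C m k).card * ‖δ m k‖ ^ 2) +
      ∑ k, (1 / 2) * ∑ m, ∑ l ∈ G.neighborFinset m, ‖δ m k - δ l k‖ ^ 2 := by
  have hJ : ∀ z : Fin M → Fin K → EuclideanSpace ℝ (Fin p), costJ ρ G z C =
      ∑ k, ((1 / ρ) * ∑ m, ((C m k).map fun y => ‖y - z m k‖ ^ 2).sum +
        (1 / 2) * ∑ m, ∑ l ∈ G.neighborFinset m, ‖z m k - z l k‖ ^ 2) := fun z => by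
    unfold costJ
    rw [Finset.sum_add_distrib, ← Finset.mul_sum, ← Finset.mul_sum, Finset.sum_comm]
    congr 2
    rw [Finset.sum_comm (s := Finset.univ) (t := Finset.univ)]
    exact Finset.sum_congr rfl fun m _ => Finset.sum_comm
  rw [hJ, hJ, ← Finset.sum_add_distrib, ← Finset.sum_add_distrib]
  refine Finset.sum_congr rfl fun k _ => ?_
  simp only [Pi.add_apply]
  rw [sum_neighbor_norm_sub_add_sq G (fun m => x m k) (fun m => δ m k)]
  simp only [sum_map_norm_sub_add_sq, Finset.sum_add_distrib, Finset.mul_sum, mul_add]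
  have hg : ∀ m, inner ℝ (halfGrad ρ G x (C m k) m k) (δ m k) =
      (1 / ρ) * inner ℝ (((C m k).card : ℝ) • x m k - (C m k).sum) (δ m k) +
      inner ℝ ((G.degree m : ℝ) • x m k - ∑ l ∈ G.neighborFinset m, x l k) (δ m k) := fun m => by
    rw [← real_inner_smul_left, ← inner_add_left]
    congr 1
    unfold halfGrad
    module
  simp only [hg, mul_add, Finset.sum_add_distrib, mul_left_comm (2 : ℝ), mul_assoc]
  ring

theorem Multiset.sum_map_finsetSum {ι α β : Type*} [AddCommMonoid β] (s : Finset ι)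
    (P : ι → Multiset α) (f : α → β) :
    ((∑ k ∈ s, P k).map f).sum = ∑ k ∈ s, ((P k).map f).sum :=
  map_sum (Multiset.sumAddMonoidHom.comp (Multiset.mapAddMonoidHom f)) P s

theorem IsKPartition.cell_le {D : Multiset (EuclideanSpace ℝ (Fin p))}
    {P : Fin K → Multiset (EuclideanSpace ℝ (Fin p))} (h : IsKPartition D P) (k : Fin K) :
    P k ≤ D :=
  h ▸ Finset.single_le_sum (fun _ _ => Multiset.zero_le _) (Finset.mem_univ k)

theorem card_le_Nstar (Dm : Fin M → Multiset (EuclideanSpace ℝ (Fin p))) (m : Fin M) :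
    (Dm m).card ≤ Nstar Dm :=
  Finset.le_sup (f := fun m => (Dm m).card) (Finset.mem_univ m)

theorem minDeg_le_degree (G : SimpleGraph (Fin M)) [DecidableRel G.Adj] (m : Fin M) :
    minDeg G ≤ G.degree m :=
  Nat.sInf_le ⟨m, rfl⟩

theorem StepOK.minDeg_pos {ρ α : ℝ} {G : SimpleGraph (Fin M)} [DecidableRel G.Adj]
    {Dm : Fin M → Multiset (EuclideanSpace ℝ (Fin p))} (hα : StepOK ρ α G Dm) (hρ : 0 < ρ) :
    (0 : ℝ) < minDeg G := by
  have := lapLamMax_nonneg G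
  have := hα.1
  exact lt_of_le_of_lt (by positivity) hα.2

theorem costQ_nonneg {ρ : ℝ} (hρ : 0 < ρ) (G : SimpleGraph (Fin M)) [DecidableRel G.Adj]
    (Dm : Fin M → Multiset (EuclideanSpace ℝ (Fin p)))
    (x : Fin M → Fin K → EuclideanSpace ℝ (Fin p)) : 0 ≤ costQ ρ G Dm x := by
  have h : ∀ m, 0 ≤ ((Dm m).map fun y => ⨅ k : Fin K, ‖y - x m k‖ ^ 2).sum := fun m => by
    refine Multiset.sum_nonneg fun a ha => ?_
    obtain ⟨y, -, rfl⟩ := Multiset.mem_map.1 ha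
    exact Real.iInf_nonneg fun k => by positivity
  have := Finset.sum_nonneg fun m (_ : m ∈ Finset.univ) => h m
  unfold costQ
  positivity

theorem costQ_le_costJ {ρ : ℝ} (hρ : 0 < ρ) (G : SimpleGraph (Fin M)) [DecidableRel G.Adj]
    {Dm : Fin M → Multiset (EuclideanSpace ℝ (Fin p))}
    (x : Fin M → Fin K → EuclideanSpace ℝ (Fin p))
    {C : Fin M → Fin K → Multiset (EuclideanSpace ℝ (Fin p))}
    (hC : ∀ m, IsKPartition (Dm m) (C m)) : costQ ρ G Dm x ≤ costJ ρ G x C := by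
  unfold costQ costJ
  gcongr with m
  rw [← hC m, Multiset.sum_map_finsetSum]
  gcongr with k
  exact Multiset.sum_map_le_sum_map _ _ fun y _ =>
    ciInf_le ⟨0, by rintro _ ⟨k, rfl⟩; positivity⟩ k

theorem InVoronoi.costJ_eq_costQ {Dm : Fin M → Multiset (EuclideanSpace ℝ (Fin p))}
    {x : Fin M → Fin K → EuclideanSpace ℝ (Fin p)}
    {C : Fin M → Fin K → Multiset (EuclideanSpace ℝ (Fin p))} (hC : InVoronoi Dm x C)
    (ρ : ℝ) (G : SimpleGraph (Fin M)) [DecidableRel G.Adj] :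
    costJ ρ G x C = costQ ρ G Dm x := by
  unfold costQ costJ
  congr 2
  refine Finset.sum_congr rfl fun m _ => ?_
  rw [← hC.1 m, Multiset.sum_map_finsetSum]
  refine Finset.sum_congr rfl fun k _ => congrArg _ (Multiset.map_congr rfl fun y hy => ?_)
  have : Nonempty (Fin K) := ⟨k⟩
  refine le_antisymm (le_ciInf fun k' => ?_) (ciInf_le ⟨0, by rintro _ ⟨k, rfl⟩; positivity⟩ k)
  gcongr
  exact hC.2 m k y hy k'

theorem halfGrad_eq_smul_sub_muVec {ρ : ℝ} (hρ : 0 < ρ) {G : SimpleGraph (Fin M)}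
    [DecidableRel G.Adj] (x : Fin M → Fin K → EuclideanSpace ℝ (Fin p))
    (C : Fin M → Fin K → Multiset (EuclideanSpace ℝ (Fin p))) {m : Fin M} (k : Fin K)
    (hdeg : (0 : ℝ) < G.degree m) :
    halfGrad ρ G x (C m k) m k =
      ((1 / ρ) * ((C m k).card : ℝ) + (G.degree m : ℝ)) • (x m k - muVec ρ G x C m k) := by
  have hw : (1 / ρ) * ((C m k).card : ℝ) + (G.degree m : ℝ) ≠ 0 := by positivity
  rw [smul_sub, muVec, smul_inv_smul₀ hw, halfGrad]

/-- One center update decreases the cost proportionally to the squared displacement `δ`. -/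
theorem costJ_add_le {ρ α : ℝ} (hρ : 0 < ρ) {G : SimpleGraph (Fin M)} [DecidableRel G.Adj]
    {Dm : Fin M → Multiset (EuclideanSpace ℝ (Fin p))} (hα : StepOK ρ α G Dm)
    {x δ : Fin M → Fin K → EuclideanSpace ℝ (Fin p)}
    {C : Fin M → Fin K → Multiset (EuclideanSpace ℝ (Fin p))}
    (hC : ∀ m, IsKPartition (Dm m) (C m))
    (hδ : ∀ m k, α • halfGrad ρ G x (C m k) m k =
      -(((1 / ρ) * ((C m k).card : ℝ) + (G.degree m : ℝ)) • δ m k)) :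
    costJ ρ G (x + δ) C + minDeg G / α * ∑ k, ∑ m, ‖δ m k‖ ^ 2 ≤ costJ ρ G x C := by
  have hα0 := hα.1
  have hstep : (1 / ρ) * (Nstar Dm : ℝ) + lapLamMax G ≤ minDeg G / α := by
    rw [le_div_iff₀ hα0, mul_comm]
    exact hα.2.le
  have hinner : ∀ m k, 2 * inner ℝ (halfGrad ρ G x (C m k) m k) (δ m k) +
      (1 / ρ) * (C m k).card * ‖δ m k‖ ^ 2 ≤
      ((1 / ρ) * Nstar Dm - 2 * (minDeg G / α)) * ‖δ m k‖ ^ 2 := fun m k => by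
    have h1 : α * inner ℝ (halfGrad ρ G x (C m k) m k) (δ m k) =
        -(((1 / ρ) * ((C m k).card : ℝ) + (G.degree m : ℝ)) * ‖δ m k‖ ^ 2) := by
      rw [← real_inner_smul_left, hδ, inner_neg_left, real_inner_smul_left,
        real_inner_self_eq_norm_sq]
    have h2 : (minDeg G : ℝ) ≤ (1 / ρ) * ((C m k).card : ℝ) + (G.degree m : ℝ) :=
      (Nat.cast_le.2 (minDeg_le_degree G m)).trans (le_add_of_nonneg_left (by positivity))
    have h3 : ((C m k).card : ℝ) ≤ Nstar Dm :=
      Nat.cast_le.2 ((Multiset.card_le_card ((hC m).cell_le k)).trans (card_le_Nstar Dm m))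
    have h4 : inner ℝ (halfGrad ρ G x (C m k) m k) (δ m k) ≤
        -(minDeg G / α * ‖δ m k‖ ^ 2) := by
      have : minDeg G / α * ‖δ m k‖ ^ 2 ≤
          ((1 / ρ) * ((C m k).card : ℝ) + (G.degree m : ℝ)) / α * ‖δ m k‖ ^ 2 := by gcongr
      have h5 : inner ℝ (halfGrad ρ G x (C m k) m k) (δ m k) =
        -(((1 / ρ) * ((C m k).card : ℝ) + (G.degree m : ℝ)) / α * ‖δ m k‖ ^ 2) := by
        field_simp
        field_simp at h1
        linarith
      linarith
    have h6 : (1 / ρ) * (C m k).card * ‖δ m k‖ ^ 2 ≤ (1 / ρ) * Nstar Dm * ‖δ m k‖ ^ 2 := by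
      gcongr
    linarith
  rw [costJ_add, add_assoc, add_assoc, Finset.mul_sum, ← Finset.sum_add_distrib,
    ← Finset.sum_add_distrib]
  refine add_le_of_nonpos_right (Finset.sum_nonpos fun k _ => ?_)
  have h1 := Finset.sum_le_sum fun m (_ : m ∈ Finset.univ) => hinner m k
  have h2 := sum_neighbor_norm_sq_le G fun m => δ m k
  have h3 := mul_le_mul_of_nonneg_right hstep
    (Finset.sum_nonneg fun m (_ : m ∈ Finset.univ) => sq_nonneg ‖δ m k‖)
  rw [← Finset.mul_sum] at h1
  linarith

/-- The (unnormalized) gradient along an NK-means trajectory tends to zero. -/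
theorem NKMeansSeq.tendsto_halfGrad {ρ α : ℝ} (hρ : 0 < ρ) {G : SimpleGraph (Fin M)}
    [DecidableRel G.Adj] {Dm : Fin M → Multiset (EuclideanSpace ℝ (Fin p))}
    (hα : StepOK ρ α G Dm) {x : ℕ → Fin M → Fin K → EuclideanSpace ℝ (Fin p)}
    {C : ℕ → Fin M → Fin K → Multiset (EuclideanSpace ℝ (Fin p))}
    (hseq : NKMeansSeq ρ α G Dm x C) (m : Fin M) (k : Fin K) :
    Filter.Tendsto (fun t => halfGrad ρ G (x t) (C (t + 1) m k) m k) Filter.atTop (nhds 0) := by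
  have hα0 := hα.1
  have hd := hα.minDeg_pos hρ
  have hdeg : ∀ m, (0 : ℝ) < G.degree m := fun m =>
    hd.trans_le (Nat.cast_le.2 (minDeg_le_degree G m))
  have hgrad : ∀ t m k, α • halfGrad ρ G (x t) (C (t + 1) m k) m k =
      -(((1 / ρ) * ((C (t + 1) m k).card : ℝ) + (G.degree m : ℝ)) •
        (x (t + 1) - x t) m k) := fun t m k => by
    rw [halfGrad_eq_smul_sub_muVec hρ _ _ _ (hdeg m), Pi.sub_apply, Pi.sub_apply,
      (hseq.2 t).2.2 m k, smul_comm, sub_sub_cancel_left, smul_neg, neg_neg]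
  set V := fun t => costQ ρ G Dm (x t)
  have hV : ∀ t, V (t + 1) + minDeg G / α * ∑ k, ∑ m, ‖(x (t + 1) - x t) m k‖ ^ 2 ≤ V t :=
    fun t => by
      have h := costJ_add_le hρ hα (hseq.2 t).1 (hgrad t)
      rw [add_sub_cancel, InVoronoi.costJ_eq_costQ ⟨(hseq.2 t).1, (hseq.2 t).2.1⟩] at h
      linarith [costQ_le_costJ hρ G (x (t + 1)) (hseq.2 t).1]
  have hanti : Antitone V := antitone_nat_of_succ_le fun t =>
    (le_add_of_nonneg_right (by positivity)).trans (hV t)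
  have hconv := tendsto_atTop_ciInf hanti
    ⟨0, by rintro _ ⟨t, rfl⟩; exact costQ_nonneg hρ G Dm (x t)⟩
  have hdiff := hconv.sub (hconv.comp (Filter.tendsto_add_atTop_nat 1))
  rw [sub_self] at hdiff
  have hsq : Filter.Tendsto (fun t => ‖(x (t + 1) - x t) m k‖ ^ 2) Filter.atTop (nhds 0) := by
    refine squeeze_zero (fun t => by positivity) (fun t => ?_)
      (by simpa using hdiff.const_mul (α / minDeg G))
    have h1 : ‖(x (t + 1) - x t) m k‖ ^ 2 ≤ ∑ k, ∑ m, ‖(x (t + 1) - x t) m k‖ ^ 2 :=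
      (Finset.single_le_sum (f := fun m => ‖(x (t + 1) - x t) m k‖ ^ 2)
        (fun _ _ => by positivity) (Finset.mem_univ m)).trans
      (Finset.single_le_sum (f := fun k => ∑ m, ‖(x (t + 1) - x t) m k‖ ^ 2)
        (fun _ _ => by positivity) (Finset.mem_univ k))
    have h2 : α / minDeg G * (minDeg G / α * ∑ k, ∑ m, ‖(x (t + 1) - x t) m k‖ ^ 2) ≤
        α / minDeg G * (V t - V (t + 1)) := by
      gcongr
      linarith [hV t]
    rw [← mul_assoc, div_mul_div_cancel₀ hd.ne', div_self hα0.ne', one_mul] at h2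
    exact h1.trans h2
  have hnorm : Filter.Tendsto (fun t => ‖(x (t + 1) - x t) m k‖) Filter.atTop (nhds 0) := by
    simpa [Real.sqrt_sq] using hsq.sqrt
  refine squeeze_zero_norm (fun t => ?_)
    (mul_zero (((1 / ρ) * (Nstar Dm : ℝ) + G.degree m) / α) ▸ hnorm.const_mul _)
  have h := congrArg norm (hgrad t m k)
  rw [norm_neg, norm_smul, norm_smul, Real.norm_of_nonneg hα0.le,
    Real.norm_of_nonneg (by positivity)] at h
  have hcard : ((C (t + 1) m k).card : ℝ) ≤ Nstar Dm := Nat.cast_le.2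
    ((Multiset.card_le_card (((hseq.2 t).1 m).cell_le k)).trans (card_le_Nstar Dm m))
  rw [div_mul_eq_mul_div, le_div_iff₀ hα0, mul_comm, h]
  gcongr

end Descent

/-- Lemma 4: if `x_{t_s} → x̆` along a subsequence, then eventually
`C_{t_s + 1} ∈ Ū_x̆` (i.e. `(x̆, C_{t_s+1})` is a generalized Lloyd's minimum). -/
theorem stmt13 {p K M : ℕ} (hK2 : 2 ≤ K)
    (Dm : Fin M → Multiset (EuclideanSpace ℝ (Fin p)))
    (D : Multiset (EuclideanSpace ℝ (Fin p))) (hD : ∑ m, Dm m = D)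
    (hdistinct : HasKDistinct K D)
    (G : SimpleGraph (Fin M)) [DecidableRel G.Adj] (hconn : G.Connected)
    (ρ α : ℝ) (hρ : 0 < ρ) (hα : StepOK ρ α G Dm)
    (x : ℕ → Fin M → Fin K → EuclideanSpace ℝ (Fin p))
    (C : ℕ → Fin M → Fin K → Multiset (EuclideanSpace ℝ (Fin p)))
    (hseq : NKMeansSeq ρ α G Dm x C)
    (xb : Fin M → Fin K → EuclideanSpace ℝ (Fin p))
    (φ : ℕ → ℕ) (hφ : StrictMono φ)
    (hlim : Filter.Tendsto (fun s => x (φ s)) Filter.atTop (nhds xb)) :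
    ∃ s' : ℕ, ∀ s, s' ≤ s → IsGenLloydMin ρ G Dm xb (C (φ s + 1)) := by
  have hx : ∀ m k, Filter.Tendsto (fun s => x (φ s) m k) Filter.atTop (nhds (xb m k)) :=
    fun m k => tendsto_pi_nhds.1 (tendsto_pi_nhds.1 hlim m) k
  have hvor : ∀ᶠ s in Filter.atTop, ∀ m k k', ∀ y ∈ {y | y ∈ Dm m},
      ‖y - xb m k'‖ < ‖y - xb m k‖ → ‖y - x (φ s) m k'‖ < ‖y - x (φ s) m k‖ := by
    refine Filter.eventually_all.2 fun m => Filter.eventually_all.2 fun k =>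
      Filter.eventually_all.2 fun k' =>
      (Filter.eventually_all_finite (Dm m).finite_toSet).2 fun y _ => ?_
    by_cases h : ‖y - xb m k'‖ < ‖y - xb m k‖
    · filter_upwards [((hx m k').const_sub y).norm.eventually_lt ((hx m k).const_sub y).norm h]
        with s hs _ using hs
    · exact Filter.Eventually.of_forall fun s h' => absurd h' h
  have hfix : ∀ᶠ s in Filter.atTop, ∀ m k, ∀ P ∈ Set.Iic (Dm m),
      halfGrad ρ G xb P m k ≠ 0 → C (φ s + 1) m k ≠ P := by
    refine Filter.eventually_all.2 fun m => Filter.eventually_all.2 fun k =>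
      (Filter.eventually_all_finite (Set.finite_Iic (Dm m))).2 fun P _ => ?_
    by_cases h : halfGrad ρ G xb P m k = 0
    · exact Filter.Eventually.of_forall fun s h' => absurd h h'
    have h0 := ((hseq.tendsto_halfGrad hρ hα m k).comp hφ.tendsto_atTop).norm
    have hP : Filter.Tendsto (fun s => halfGrad ρ G (x (φ s)) P m k) Filter.atTop
        (nhds (halfGrad ρ G xb P m k)) :=
      ((hx m k).const_smul _).sub (tendsto_const_nhds.add (tendsto_finsetSum _ fun l _ => hx l k))
    filter_upwards [h0.eventually_lt hP.norm (by simpa using h)] with s hs _ hCP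
    simp [hCP] at hs
  obtain ⟨s', hs'⟩ := Filter.eventually_atTop.1 (hvor.and hfix)
  refine ⟨s', fun s hs => ?_⟩
  obtain ⟨hv, hf⟩ := hs' s hs
  obtain ⟨hpart, hnear, -⟩ := hseq.2 (φ s)
  refine ⟨⟨hpart, fun m k y hy k' => ?_⟩, fun m k => ?_⟩
  · by_contra! hlt
    exact (hv m k k' y (Multiset.mem_of_le ((hpart m).cell_le k) hy) hlt).not_ge (hnear m k y hy k')
  · by_contra hne
    exact hf m k _ ((hpart m).cell_le k) (sub_ne_zero.2 hne) rfl
end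
end

section
/- Let the dataset contain at least K distinct points and the communication graph be connected. Fix ρ > 0 and suppose (x̆, C) is a global minimizer of J^ρ(·,·). Then for every k ∈ {1,…,K}, the union C_1^k ∪ C_2^k ∪ … ∪ C_M^k is nonempty; i.e. at a global minimum no aggregated cluster is empty. -/
open scoped BigOperators

noncomputable section

/-- The distortion of the centers `x` on the cells `C`, summed over all agents. -/
def totalDistortion {p K M : ℕ} (x : Fin M → Fin K → EuclideanSpace ℝ (Fin p))
    (C : Fin M → Fin K → Multiset (EuclideanSpace ℝ (Fin p))) : ℝ :=
  ∑ m, ∑ k, ((C m k).map fun y => ‖y - x m k‖ ^ 2).sum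

/-- The disagreement of the centers `x` along the edges of `G`. -/
def disagreement {p K M : ℕ} (G : SimpleGraph (Fin M)) [DecidableRel G.Adj]
    (x : Fin M → Fin K → EuclideanSpace ℝ (Fin p)) : ℝ :=
  (1 / 2) * ∑ m, ∑ l ∈ G.neighborFinset m, ∑ k, ‖x m k - x l k‖ ^ 2

theorem costJ_eq_totalDistortion_add_disagreement {p K M : ℕ} (ρ : ℝ)
    (G : SimpleGraph (Fin M)) [DecidableRel G.Adj]
    (x : Fin M → Fin K → EuclideanSpace ℝ (Fin p))
    (C : Fin M → Fin K → Multiset (EuclideanSpace ℝ (Fin p))) :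
    costJ ρ G x C = (1 / ρ) * totalDistortion x C + disagreement G x :=
  rfl

theorem sum_map_norm_sq_nonneg {E : Type*} [NormedAddCommGroup E] (s : Multiset E) (c : E) :
    0 ≤ (s.map fun y => ‖y - c‖ ^ 2).sum :=
  Multiset.sum_nonneg (by simp only [Multiset.mem_map]; rintro _ ⟨y, -, rfl⟩; positivity)

theorem totalDistortion_nonneg {p K M : ℕ} (x : Fin M → Fin K → EuclideanSpace ℝ (Fin p))
    (C : Fin M → Fin K → Multiset (EuclideanSpace ℝ (Fin p))) : 0 ≤ totalDistortion x C :=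
  Finset.sum_nonneg fun _ _ => Finset.sum_nonneg fun _ _ => sum_map_norm_sq_nonneg _ _

theorem disagreement_nonneg {p K M : ℕ} (G : SimpleGraph (Fin M)) [DecidableRel G.Adj]
    (x : Fin M → Fin K → EuclideanSpace ℝ (Fin p)) : 0 ≤ disagreement G x := by
  unfold disagreement
  positivity

/-- Moving the `k`-th center of every agent to a common point does not increase the
disagreement. -/
theorem disagreement_update_le {p K M : ℕ} (G : SimpleGraph (Fin M)) [DecidableRel G.Adj]
    (x : Fin M → Fin K → EuclideanSpace ℝ (Fin p)) (k : Fin K) (y : EuclideanSpace ℝ (Fin p)) :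
    disagreement G (fun m => Function.update (x m) k y) ≤ disagreement G x := by
  unfold disagreement
  gcongr with m _ l _ j _
  obtain rfl | hj := eq_or_ne j k
  · simp
  · simp [hj]

theorem disagreement_smul {p K M : ℕ} (G : SimpleGraph (Fin M)) [DecidableRel G.Adj]
    (x : Fin M → Fin K → EuclideanSpace ℝ (Fin p)) (c : ℝ) :
    disagreement G (c • x) = c ^ 2 * disagreement G x := by
  simp only [disagreement, Pi.smul_apply, ← smul_sub, norm_smul, mul_pow, Real.norm_eq_abs,
    sq_abs, ← Finset.mul_sum]
  ring

/-- On a connected graph, centers without disagreement are common to all agents. -/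
theorem eq_of_disagreement_eq_zero {p K M : ℕ} {G : SimpleGraph (Fin M)} [DecidableRel G.Adj]
    (hG : G.Connected) {x : Fin M → Fin K → EuclideanSpace ℝ (Fin p)}
    (hx : disagreement G x = 0) (m l : Fin M) : x m = x l := by
  have hadj : ∀ m l, G.Adj m l → x m = x l := by
    intro m l hml
    have h : ∑ m, ∑ l ∈ G.neighborFinset m, ∑ k, ‖x m k - x l k‖ ^ 2 = 0 := by
      simpa [disagreement] using hx
    rw [Finset.sum_eq_zero_iff_of_nonneg fun _ _ => by positivity] at h
    have h := h m (Finset.mem_univ m)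
    rw [Finset.sum_eq_zero_iff_of_nonneg fun _ _ => by positivity] at h
    have h := h l (by simpa using hml)
    rw [Finset.sum_eq_zero_iff_of_nonneg fun _ _ => by positivity] at h
    funext k
    simpa [sub_eq_zero] using h k (Finset.mem_univ k)
  obtain ⟨w⟩ := hG.preconnected m l
  induction w with
  | nil => rfl
  | cons h _ ih => exact (hadj _ _ h).trans ih

/-- If every point sits exactly on its center, then contracting the centers by the factor `1 - t`
produces `t ^ 2` times the distortion of the zero centers. -/
theorem totalDistortion_one_sub_smul {p K M : ℕ} {x : Fin M → Fin K → EuclideanSpace ℝ (Fin p)}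
    {C : Fin M → Fin K → Multiset (EuclideanSpace ℝ (Fin p))}
    (h : ∀ m k, ∀ y ∈ C m k, y = x m k) (t : ℝ) :
    totalDistortion ((1 - t) • x) C = t ^ 2 * totalDistortion 0 C := by
  simp only [totalDistortion, Finset.mul_sum, ← Multiset.sum_map_mul_left]
  refine Finset.sum_congr rfl fun m _ => Finset.sum_congr rfl fun k _ => ?_
  refine congrArg Multiset.sum (Multiset.map_congr rfl fun y hy => ?_)
  have hxy : y - ((1 - t) • x) m k = t • y := by
    rw [Pi.smul_apply, Pi.smul_apply, ← h m k y hy, sub_smul, one_smul, sub_sub_cancel]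
  rw [hxy, norm_smul, mul_pow, Real.norm_eq_abs, sq_abs]
  simp

/-- Minimality of `t ^ 2 * b + (1 - t) ^ 2 * a` at `t = 0` forces `a ≤ 0`. -/
theorem nonpos_of_forall_le_sq_combination {a b : ℝ} (hb : 0 ≤ b)
    (h : ∀ t : ℝ, a ≤ t ^ 2 * b + (1 - t) ^ 2 * a) : a ≤ 0 := by
  by_contra! ha'
  have hab : 0 < a + b := by positivity
  have h := h (a / (a + b))
  have hid : (a / (a + b)) ^ 2 * b + (1 - a / (a + b)) ^ 2 * a = a * b / (a + b) := by
    field_simp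
    ring
  rw [hid, le_div_iff₀ hab] at h
  nlinarith

/-- If some cluster is empty for every agent, then at a global minimum of `J^ρ` every point
coincides with the center of its cell: otherwise it could be given a cluster of its own. -/
theorem eq_center_of_forall_costJ_le {p K M : ℕ}
    {Dm : Fin M → Multiset (EuclideanSpace ℝ (Fin p))}
    {G : SimpleGraph (Fin M)} [DecidableRel G.Adj] {ρ : ℝ} (hρ : 0 < ρ)
    {x : Fin M → Fin K → EuclideanSpace ℝ (Fin p)}
    {C : Fin M → Fin K → Multiset (EuclideanSpace ℝ (Fin p))}
    (hpart : ∀ m, IsKPartition (Dm m) (C m))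
    (hglob : ∀ (x' : Fin M → Fin K → EuclideanSpace ℝ (Fin p))
        (C' : Fin M → Fin K → Multiset (EuclideanSpace ℝ (Fin p))),
      (∀ m, IsKPartition (Dm m) (C' m)) → costJ ρ G x C ≤ costJ ρ G x' C')
    {k₀ : Fin K} (hk₀ : ∀ m, C m k₀ = 0) {m : Fin M} {k : Fin K}
    {y : EuclideanSpace ℝ (Fin p)} (hy : y ∈ C m k) : y = x m k := by
  classical
  by_contra hne
  have hk : k ≠ k₀ := by
    rintro rfl
    simp [hk₀ m] at hy
  obtain ⟨t, ht⟩ := Multiset.exists_cons_of_mem hy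
  set x' : Fin M → Fin K → EuclideanSpace ℝ (Fin p) := fun l => Function.update (x l) k₀ y with hx'
  set P : Fin K → Multiset (EuclideanSpace ℝ (Fin p)) :=
    Function.update (Function.update (C m) k t) k₀ {y} with hP
  set C' := Function.update C m P with hC'
  have hpart' : ∀ l, IsKPartition (Dm l) (C' l) := by
    intro l
    obtain rfl | hl := eq_or_ne l m
    · have hmove : P + Pi.single k {y} = C l + Pi.single k₀ {y} := by
        funext j
        obtain rfl | hj₀ := eq_or_ne j k₀
        · simp [hP, hk₀, hk.symm]
        · obtain rfl | hj := eq_or_ne j k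
          · simp [hP, hk, ht, add_comm t]
          · simp [hP, hj₀, hj]
      have hsum := congrArg (fun Q => ∑ j, Q j) hmove
      simp only [Pi.add_apply, Finset.sum_add_distrib, Finset.sum_pi_single', Finset.mem_univ,
        if_true, add_left_inj] at hsum
      simpa [IsKPartition, hC'] using hsum.trans (hpart l)
    · simpa [hC', hl] using hpart l
  have hle : ∀ l j, ((C' l j).map fun z => ‖z - x' l j‖ ^ 2).sum ≤
      ((C l j).map fun z => ‖z - x l j‖ ^ 2).sum := by
    intro l j
    obtain rfl | hj₀ := eq_or_ne j k₀
    · obtain rfl | hl := eq_or_ne l m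
      · simp [hC', hP, hx', hk₀]
      · simp [hC', hl, hk₀]
    · obtain rfl | hl := eq_or_ne l m
      · obtain rfl | hj := eq_or_ne j k
        · simp [hC', hP, hx', hk, ht]
        · simp [hC', hP, hx', hj₀, hj]
      · simp [hC', hl, hx', hj₀]
  have hlt : ((C' m k).map fun z => ‖z - x' m k‖ ^ 2).sum <
      ((C m k).map fun z => ‖z - x m k‖ ^ 2).sum := by
    have hpos : 0 < ‖y - x m k‖ ^ 2 := pow_pos (norm_pos_iff.mpr (sub_ne_zero.mpr hne)) 2
    simpa [hC', hP, hx', hk, ht] using hpos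
  have hdist : totalDistortion x' C' < totalDistortion x C :=
    Finset.sum_lt_sum (fun l _ => Finset.sum_le_sum fun j _ => hle l j)
      ⟨m, Finset.mem_univ m,
        Finset.sum_lt_sum (fun j _ => hle m j) ⟨k, Finset.mem_univ k, hlt⟩⟩
  refine (hglob x' C' hpart').not_gt ?_
  simp only [costJ_eq_totalDistortion_add_disagreement]
  have hρ' : 0 < 1 / ρ := by positivity
  exact add_lt_add_of_lt_of_le (mul_lt_mul_of_pos_left hdist hρ') (disagreement_update_le G x k₀ y)

/-- Lemma 6: at a global minimum of `J^ρ`, every aggregated cluster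
`C_1^k ∪ ⋯ ∪ C_M^k` is nonempty. -/
theorem stmt15 {p K M : ℕ} (hK2 : 2 ≤ K)
    (Dm : Fin M → Multiset (EuclideanSpace ℝ (Fin p)))
    (D : Multiset (EuclideanSpace ℝ (Fin p))) (hD : ∑ m, Dm m = D)
    (hdistinct : HasKDistinct K D)
    (G : SimpleGraph (Fin M)) [DecidableRel G.Adj] (hconn : G.Connected)
    (ρ : ℝ) (hρ : 0 < ρ)
    (x : Fin M → Fin K → EuclideanSpace ℝ (Fin p))
    (C : Fin M → Fin K → Multiset (EuclideanSpace ℝ (Fin p)))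
    (hpart : ∀ m, IsKPartition (Dm m) (C m))
    (hglob : ∀ (x' : Fin M → Fin K → EuclideanSpace ℝ (Fin p))
        (C' : Fin M → Fin K → Multiset (EuclideanSpace ℝ (Fin p))),
      (∀ m, IsKPartition (Dm m) (C' m)) → costJ ρ G x C ≤ costJ ρ G x' C') :
    ∀ k : Fin K, ∑ m, C m k ≠ 0 := by
  intro k₀ hempty
  have hk₀ : ∀ m, C m k₀ = 0 := fun m => by simpa using Finset.sum_eq_zero_iff.mp hempty m
  have hcenter : ∀ m k, ∀ y ∈ C m k, y = x m k := fun m k y hy =>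
    eq_center_of_forall_costJ_le hρ hpart hglob hk₀ hy
  have hdist : totalDistortion x C = 0 := by
    simpa using totalDistortion_one_sub_smul hcenter 0
  have hdis : disagreement G x = 0 := by
    refine le_antisymm (nonpos_of_forall_le_sq_combination
      (b := (1 / ρ) * totalDistortion 0 C)
      (mul_nonneg (by positivity) (totalDistortion_nonneg 0 C)) fun t => ?_) (disagreement_nonneg G x)
    have h := hglob ((1 - t) • x) C hpart
    rw [costJ_eq_totalDistortion_add_disagreement, costJ_eq_totalDistortion_add_disagreement,
      hdist, totalDistortion_one_sub_smul hcenter, disagreement_smul] at h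
    linarith
  obtain ⟨m₀⟩ := hconn.nonempty
  obtain ⟨S, hcard, hS⟩ := hdistinct
  classical
  have hsub : S ⊆ (Finset.univ.erase k₀).image (x m₀) := by
    intro y hy
    have hyD := hS y hy
    rw [← hD, Multiset.mem_sum] at hyD
    obtain ⟨m, -, hym⟩ := hyD
    rw [← hpart m, Multiset.mem_sum] at hym
    obtain ⟨k, -, hyk⟩ := hym
    refine Finset.mem_image.mpr ⟨k, Finset.mem_erase.mpr ⟨?_, Finset.mem_univ k⟩, ?_⟩
    · rintro rfl
      simp [hk₀ m] at hyk
    · rw [hcenter m k y hyk, eq_of_disagreement_eq_zero hconn hdis m₀ m]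
  have hle := (Finset.card_le_card hsub).trans Finset.card_image_le
  rw [hcard, Finset.card_erase_of_mem (Finset.mem_univ k₀), Finset.card_univ,
    Fintype.card_fin] at hle
  omega
end
end

section
/- Let the dataset contain at least K distinct points and the communication graph be connected. Then for every ρ > 0 and every global minimizer x̆ of Q^ρ (x̆ ∈ M^ρ_g), the centers satisfy x̆_m^k ∈ closed convex hull of D for all m = 1,…,M and k = 1,…,K. -/
open scoped BigOperators

noncomputable section

/-- Firm nonexpansiveness: `a` and `b` play the role of the projections of `v` and `w` onto a
convex set. -/
lemma sq_norm_sub_add_sq_norm_sub_le {F : Type*} [NormedAddCommGroup F] [InnerProductSpace ℝ F]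
    {v w a b : F} (hv : inner ℝ (v - a) (b - a) ≤ 0) (hw : inner ℝ (w - b) (a - b) ≤ 0) :
    ‖a - b‖ ^ 2 + ‖(v - a) - (w - b)‖ ^ 2 ≤ ‖v - w‖ ^ 2 := by
  have e : v - w = (a - b) + ((v - a) - (w - b)) := by abel
  have h1 : inner ℝ (a - b) ((v - a) - (w - b)) =
      -inner ℝ (v - a) (b - a) - inner ℝ (w - b) (a - b) := by
    rw [inner_sub_right, real_inner_comm (v - a), real_inner_comm (w - b), ← neg_sub b a,
      inner_neg_right]
  rw [e, norm_add_sq_real, h1]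
  linarith

/-- A nonempty compact convex set has a projection map satisfying the variational inequality. -/
lemma exists_projection_of_isCompact {F : Type*} [NormedAddCommGroup F] [InnerProductSpace ℝ F]
    {H : Set F} (hc : IsCompact H) (hconv : Convex ℝ H) (hne : H.Nonempty) :
    ∃ P : F → F, ∀ v, P v ∈ H ∧ ∀ y ∈ H, inner ℝ (v - P v) (y - P v) ≤ 0 := by
  have h : ∀ v, ∃ a ∈ H, ∀ y ∈ H, inner ℝ (v - a) (y - a) ≤ 0 := fun v => by
    obtain ⟨a, ha, he⟩ := exists_norm_eq_iInf_of_complete_convex hne hc.isComplete hconv v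
    exact ⟨a, ha, (norm_eq_iInf_iff_real_inner_le_zero hconv ha).1 he⟩
  choose P h1 h2 using h
  exact ⟨P, fun v => ⟨h1 v, h2 v⟩⟩

section CostComparison

variable {p K M : ℕ} {ρ : ℝ} {G : SimpleGraph (Fin M)} [DecidableRel G.Adj]
  {Dm : Fin M → Multiset (EuclideanSpace ℝ (Fin p))}
  {x x' : Fin M → Fin K → EuclideanSpace ℝ (Fin p)}

lemma iInf_sq_le (y : EuclideanSpace ℝ (Fin p)) (c : Fin K → EuclideanSpace ℝ (Fin p))
    (j : Fin K) : ⨅ k, ‖y - c k‖ ^ 2 ≤ ‖y - c j‖ ^ 2 :=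
  ciInf_le (Set.finite_range _).bddBelow j

/-- A global minimizer cannot be weakly improved termwise: every term must be equal. -/
lemma terms_eq_of_mem_globQ (hρ : 0 < ρ) (hglob : x ∈ globQ ρ G Dm K)
    (hdata : ∀ m, ∀ y ∈ Dm m, ⨅ k, ‖y - x' m k‖ ^ 2 ≤ ⨅ k, ‖y - x m k‖ ^ 2)
    (hedge : ∀ m l, G.Adj m l → ∀ k, ‖x' m k - x' l k‖ ^ 2 ≤ ‖x m k - x l k‖ ^ 2) :
    (∀ m, ∀ y ∈ Dm m, ⨅ k, ‖y - x' m k‖ ^ 2 = ⨅ k, ‖y - x m k‖ ^ 2) ∧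
      ∀ m l, G.Adj m l → ∀ k, ‖x' m k - x' l k‖ ^ 2 = ‖x m k - x l k‖ ^ 2 := by
  have hQ := hglob x'
  unfold costQ at hQ
  have hρ' : 0 < 1 / ρ := by positivity
  have hd : ∀ m, ((Dm m).map fun y => ⨅ k, ‖y - x' m k‖ ^ 2).sum ≤
      ((Dm m).map fun y => ⨅ k, ‖y - x m k‖ ^ 2).sum :=
    fun m => Multiset.sum_map_le_sum_map _ _ (hdata m)
  have he : ∀ m, ∀ l ∈ G.neighborFinset m, ∑ k, ‖x' m k - x' l k‖ ^ 2 ≤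
      ∑ k, ‖x m k - x l k‖ ^ 2 :=
    fun m l hl => Finset.sum_le_sum fun k _ => hedge m l (by simpa using hl) k
  have hd' := Finset.sum_le_sum fun m (_ : m ∈ Finset.univ) => hd m
  have he' := Finset.sum_le_sum fun m (_ : m ∈ Finset.univ) => Finset.sum_le_sum (he m)
  have hd'' := mul_le_mul_of_nonneg_left hd' hρ'.le
  constructor
  · intro m y hy
    refine (hdata m y hy).antisymm (not_lt.1 fun hlt => ?_)
    have h1 := Multiset.sum_lt_sum (hdata m) ⟨y, hy, hlt⟩
    have h2 := mul_lt_mul_of_pos_left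
      (Finset.sum_lt_sum (fun m _ => hd m) ⟨m, Finset.mem_univ m, h1⟩) hρ'
    linarith
  · intro m l hml k
    refine (hedge m l hml k).antisymm (not_lt.1 fun hlt => ?_)
    have h1 := Finset.sum_lt_sum (fun k _ => hedge m l hml k) ⟨k, Finset.mem_univ k, hlt⟩
    have h2 := Finset.sum_lt_sum (he m) ⟨l, by simpa using hml, h1⟩
    have h3 := Finset.sum_lt_sum (fun m _ => Finset.sum_le_sum (he m))
      ⟨m, Finset.mem_univ m, h2⟩
    linarith

/-- If every data point is a center of its agent at a global minimizer, then neighboring agents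
agree on all centers. -/
lemma eq_of_adj_of_mem_globQ (hρ : 0 < ρ) (hglob : x ∈ globQ ρ G Dm K)
    (hcov : ∀ m, ∀ y ∈ Dm m, ∃ j, x m j = y) {m l : Fin M} (hml : G.Adj m l) (k : Fin K) :
    x m k = x l k := by
  set E : ℝ := (1 / 2) * ∑ m, ∑ l ∈ G.neighborFinset m, ∑ k, ‖x m k - x l k‖ ^ 2 with hE
  set B : ℝ := (1 / ρ) * ∑ m, ((Dm m).map fun y => ‖y‖ ^ 2).sum with hB
  have hB0 : 0 ≤ B := by
    refine mul_nonneg (by positivity) (Finset.sum_nonneg fun m _ => Multiset.sum_nonneg ?_)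
    simp only [Multiset.mem_map]
    rintro _ ⟨y, -, rfl⟩
    positivity
  have hle : ∀ t : ℝ, E ≤ t ^ 2 * B + (1 - t) ^ 2 * E := by
    intro t
    have hEx : E ≤ costQ ρ G Dm x := by
      refine le_add_of_nonneg_left (mul_nonneg (by positivity)
        (Finset.sum_nonneg fun m _ => Multiset.sum_nonneg ?_))
      simp only [Multiset.mem_map]
      rintro _ ⟨y, -, rfl⟩
      exact Real.iInf_nonneg fun _ => by positivity
    refine (hEx.trans (hglob fun m k => (1 - t) • x m k)).trans ?_
    refine add_le_add ?_ (le_of_eq ?_)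
    · rw [hB, mul_left_comm]
      refine mul_le_mul_of_nonneg_left ?_ (by positivity)
      rw [Finset.mul_sum]
      refine Finset.sum_le_sum fun m _ => ?_
      rw [← Multiset.sum_map_mul_left]
      refine Multiset.sum_map_le_sum_map _ _ fun y hy => ?_
      obtain ⟨j, rfl⟩ := hcov m y hy
      refine (iInf_sq_le _ _ j).trans (le_of_eq ?_)
      rw [show x m j - (1 - t) • x m j = t • x m j by module, norm_smul, mul_pow,
        Real.norm_eq_abs, sq_abs]
    · simp only [hE, ← smul_sub, norm_smul, mul_pow, Real.norm_eq_abs, sq_abs, ← Finset.mul_sum]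
      ring
  have hE0 : E ≤ 0 := by
    by_contra! hpos
    have ht : E / (E + B) * (E + B) = E := div_mul_cancel₀ _ (by positivity)
    have htpos : 0 < E / (E + B) := by positivity
    have := hle (E / (E + B))
    nlinarith
  have hsum : ∑ m, ∑ l ∈ G.neighborFinset m, ∑ k, ‖x m k - x l k‖ ^ 2 = 0 :=
    le_antisymm (by linarith) (by positivity)
  rw [Finset.sum_eq_zero_iff_of_nonneg fun _ _ => by positivity] at hsum
  have h1 := hsum m (Finset.mem_univ m)
  rw [Finset.sum_eq_zero_iff_of_nonneg fun _ _ => by positivity] at h1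
  have h2 := h1 l (by simpa using hml)
  rw [Finset.sum_eq_zero_iff_of_nonneg fun _ _ => by positivity] at h2
  exact sub_eq_zero.1 (norm_eq_zero.1 (pow_eq_zero_iff two_ne_zero |>.1 (h2 k (Finset.mem_univ k))))

end CostComparison

/-- A function on the vertices of a connected graph that agrees on neighbors is constant. -/
lemma SimpleGraph.Connected.eq_of_forall_adj {V α : Type*} {G : SimpleGraph V} (hG : G.Connected)
    {f : V → α} (hf : ∀ u v, G.Adj u v → f u = f v) (u v : V) : f u = f v := by
  obtain ⟨w⟩ := hG.preconnected u v
  induction w with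
  | nil => rfl
  | cons h _ ih => exact (hf _ _ h).trans ih

/-- Lemma 7: every global minimizer of `Q^ρ` has all of its centers
in the (closed) convex hull of the collective dataset `D`. -/
theorem stmt16 {p K M : ℕ} (hK2 : 2 ≤ K)
    (Dm : Fin M → Multiset (EuclideanSpace ℝ (Fin p)))
    (D : Multiset (EuclideanSpace ℝ (Fin p))) (hD : ∑ m, Dm m = D)
    (hdistinct : HasKDistinct K D)
    (G : SimpleGraph (Fin M)) [DecidableRel G.Adj] (hconn : G.Connected)
    (ρ : ℝ) (hρ : 0 < ρ)
    (x : Fin M → Fin K → EuclideanSpace ℝ (Fin p))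
    (hglob : x ∈ globQ ρ G Dm K) :
    ∀ (m : Fin M) (k : Fin K), x m k ∈ convexHull ℝ {y | y ∈ D} := by
  intro m₀ k₀
  by_contra hout
  obtain ⟨S, hScard, hS⟩ := hdistinct
  have : Nonempty (Fin K) := ⟨k₀⟩
  have hmem : ∀ {m y}, y ∈ Dm m → y ∈ D := fun {m y} hy => by
    rw [← hD, Multiset.mem_sum]
    exact ⟨m, Finset.mem_univ m, hy⟩
  have hfin : {y | y ∈ D}.Finite := by
    classical
    exact D.toFinset.finite_toSet.subset fun y hy => by simpa using hy
  have hne : {y | y ∈ D}.Nonempty := by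
    obtain ⟨y, hy⟩ := Finset.card_pos.1 (by omega : 0 < S.card)
    exact ⟨y, hS y hy⟩
  obtain ⟨P, hP⟩ := exists_projection_of_isCompact (hfin.isCompact_convexHull (𝕜 := ℝ))
    (convex_convexHull ℝ {y | y ∈ D}) hne.convexHull
  have hdist : ∀ {y} v, y ∈ D → ‖y - P v‖ ^ 2 + ‖v - P v‖ ^ 2 ≤ ‖y - v‖ ^ 2 := by
    intro y v hy
    have h := sq_norm_sub_add_sq_norm_sub_le (w := y)
      ((hP v).2 y (subset_convexHull ℝ _ hy)) (by simp : inner ℝ (y - y) (P v - y) ≤ 0)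
    rwa [sub_self, sub_zero, norm_sub_rev (P v), norm_sub_rev v y] at h
  have hfirm := fun v w => sq_norm_sub_add_sq_norm_sub_le
    ((hP v).2 _ (hP w).1) ((hP w).2 _ (hP v).1)
  obtain ⟨hdata, hedge⟩ := terms_eq_of_mem_globQ (x' := fun m k => P (x m k)) hρ hglob
    (fun m y hy => ciInf_mono (Set.finite_range _).bddBelow fun k => by
      have := hdist (x m k) (hmem hy)
      nlinarith [sq_nonneg ‖x m k - P (x m k)‖])
    (fun m l _ k => by
      have := hfirm (x m k) (x l k)
      nlinarith [sq_nonneg ‖(x m k - P (x m k)) - (x l k - P (x l k))‖])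
  have hoff : ∀ m, x m k₀ - P (x m k₀) = x m₀ k₀ - P (x m₀ k₀) := fun m =>
    hconn.eq_of_forall_adj (f := fun m => x m k₀ - P (x m k₀)) (fun u v huv => by
      have h1 := hfirm (x u k₀) (x v k₀)
      rw [hedge u v huv k₀] at h1
      have h2 : ‖(x u k₀ - P (x u k₀)) - (x v k₀ - P (x v k₀))‖ ^ 2 = 0 :=
        le_antisymm (by linarith) (sq_nonneg _)
      exact sub_eq_zero.1 (norm_eq_zero.1 (pow_eq_zero_iff two_ne_zero |>.1 h2))) m m₀
  have hoff_pos : ∀ m, 0 < ‖x m k₀ - P (x m k₀)‖ := fun m => by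
    rw [hoff m, norm_pos_iff, sub_ne_zero]
    intro h
    exact hout (h ▸ (hP _).1)
  -- the center `k₀` serves no data point
  have hidle : ∀ m, ∀ y ∈ Dm m, ∃ j ≠ k₀, ‖y - x m j‖ ^ 2 = ⨅ k, ‖y - x m k‖ ^ 2 := by
    intro m y hy
    obtain ⟨j, hj⟩ := exists_eq_ciInf_of_finite (f := fun k => ‖y - x m k‖ ^ 2)
    refine ⟨j, ?_, hj⟩
    rintro rfl
    have h1 := hdist (x m j) (hmem hy)
    have h2 := iInf_sq_le y (fun k => P (x m k)) j
    have h3 := hdata m y hy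
    have h4 := pow_pos (hoff_pos m) 2
    linarith
  have hcov : ∀ m, ∀ y ∈ Dm m, ∃ j ≠ k₀, x m j = y := by
    intro m y hy
    obtain ⟨h, -⟩ := terms_eq_of_mem_globQ (x' := fun m => Function.update (x m) k₀ y) hρ hglob
      (fun m z hz => by
        obtain ⟨j, hj, he⟩ := hidle m z hz
        rw [← he]
        simpa [hj] using iInf_sq_le z (Function.update (x m) k₀ y) j)
      (fun m l _ k => by
        by_cases hk : k = k₀
        · subst hk
          simp
        · simp [hk])
    obtain ⟨j, hj, he⟩ := hidle m y hy
    refine ⟨j, hj, ?_⟩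
    have h1 := iInf_sq_le y (Function.update (x m) k₀ y) k₀
    rw [h m y hy, ← he] at h1
    have h2 : ‖y - x m j‖ ^ 2 = 0 := le_antisymm (by simpa using h1) (sq_nonneg _)
    exact (sub_eq_zero.1 (norm_eq_zero.1 (pow_eq_zero_iff two_ne_zero |>.1 h2))).symm
  have hcons : ∀ m, x m = x m₀ := fun m => hconn.eq_of_forall_adj (fun u v huv => funext fun k =>
    eq_of_adj_of_mem_globQ hρ hglob
      (fun m y hy => (hcov m y hy).imp fun _ h => h.2) huv k) m m₀
  classical
  have hsub : S ⊆ (Finset.univ.erase k₀).image (x m₀) := by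
    intro y hy
    have hyD := hS y hy
    rw [← hD, Multiset.mem_sum] at hyD
    obtain ⟨m, -, hm⟩ := hyD
    obtain ⟨j, hj, rfl⟩ := hcov m y hm
    exact Finset.mem_image.2 ⟨j, by simp [hj], by rw [hcons m]⟩
  have h1 := (Finset.card_le_card hsub).trans Finset.card_image_le
  rw [Finset.card_erase_of_mem (Finset.mem_univ _), Finset.card_univ, Fintype.card_fin] at h1
  omega
end
end

section
/- Consider the constrained multi-agent problem of minimizing ∑_{m=1}^M ∑_{k=1}^K ∑_{y∈C_m^k} ‖y − x_m^k‖² over admissible tuples ((x_1,C_1),…,(x_M,C_M)) with C_m ∈ ℂ_m, subject to x_1 = x_2 = … = x_M. If ((x̆_1,C̆_1),…,(x̆_M,C̆_M)) is a global minimizer of this constrained problem, then setting x̆ = x̆_1 = … = x̆_M and P^k = C̆_1^k ∪ … ∪ C̆_M^k for k = 1,…,K, the pair (x̆, P) is a global minimizer of H over all center K-tuples and K-cell partitions of D. Conversely, if (x̆, P̆) is a global minimizer of H, then the tuple ((x̆, C̆_1),…,(x̆, C̆_M)) with C̆_m^k = P̆^k ∩ D_m for all m, k is a global minimizer of the constrained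 problem. -/
open scoped BigOperators

noncomputable section

/-- The cost is additive when the cells are pooled across the agents. -/
theorem costH_sum {p K M : ℕ} (x : Fin K → EuclideanSpace ℝ (Fin p))
    (C : Fin M → Fin K → Multiset (EuclideanSpace ℝ (Fin p))) :
    costH x (fun k => ∑ m, C m k) = ∑ m, costH x (C m) := by
  unfold costH
  rw [Finset.sum_comm]
  refine Finset.sum_congr rfl fun k _ => ?_
  exact map_sum (Multiset.sumAddMonoidHom.comp
    (Multiset.mapAddMonoidHom fun y => ‖y - x k‖ ^ 2)) (fun m => C m k) Finset.univ

theorem isKPartition_sum {p K M : ℕ}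
    {Dm : Fin M → Multiset (EuclideanSpace ℝ (Fin p))}
    {C : Fin M → Fin K → Multiset (EuclideanSpace ℝ (Fin p))}
    (hC : ∀ m, IsKPartition (Dm m) (C m)) :
    IsKPartition (∑ m, Dm m) (fun k => ∑ m, C m k) := by
  unfold IsKPartition at *
  rw [Finset.sum_comm]
  exact Finset.sum_congr rfl fun m _ => hC m

theorem isKPartition_filter {p K : ℕ} (f : EuclideanSpace ℝ (Fin p) → Fin K)
    (s : Multiset (EuclideanSpace ℝ (Fin p))) :
    IsKPartition s (fun k => s.filter fun y => f y = k) := by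
  unfold IsKPartition
  induction s using Multiset.induction_on with
  | empty => simp
  | cons a s ih =>
    simp only [Multiset.filter_cons, Finset.sum_add_distrib, ih]
    simp

/-- Reassigning every point to a nearest center does not increase the cost. -/
theorem costH_nearest_le {p K : ℕ} {x : Fin K → EuclideanSpace ℝ (Fin p)}
    {f : EuclideanSpace ℝ (Fin p) → Fin K} (hf : ∀ y k, ‖y - x (f y)‖ ^ 2 ≤ ‖y - x k‖ ^ 2)
    {D : Multiset (EuclideanSpace ℝ (Fin p))} {P Q : Fin K → Multiset (EuclideanSpace ℝ (Fin p))}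
    (hP : IsKPartition D P) (hQ : IsKPartition D Q) (hPf : ∀ k, ∀ y ∈ P k, f y = k) :
    costH x P ≤ costH x Q := by
  have key : ∀ R : Fin K → Multiset (EuclideanSpace ℝ (Fin p)), IsKPartition D R →
      (D.map fun y => ‖y - x (f y)‖ ^ 2).sum =
        ∑ k, ((R k).map fun y => ‖y - x (f y)‖ ^ 2).sum := by
    rintro R rfl
    exact map_sum (Multiset.sumAddMonoidHom.comp
      (Multiset.mapAddMonoidHom fun y => ‖y - x (f y)‖ ^ 2)) R Finset.univ
  calc costH x P = ∑ k, ((P k).map fun y => ‖y - x (f y)‖ ^ 2).sum := by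
        refine Finset.sum_congr rfl fun k _ => ?_
        exact congrArg Multiset.sum (Multiset.map_congr rfl fun y hy => by rw [hPf k y hy])
    _ = ∑ k, ((Q k).map fun y => ‖y - x (f y)‖ ^ 2).sum := by rw [← key P hP, key Q hQ]
    _ ≤ costH x Q := Finset.sum_le_sum fun k _ =>
        Multiset.sum_map_le_sum_map _ _ fun y _ => hf y k

/-- equivalence between the consensus-constrained multi-agent
formulation and the centralized formulation `inf H`.  In the converse direction, the
clustering `C̆_m^k = P̆^k ∩ D_m` is rendered, in the multiset setting, as an arbitrary
decomposition of `P̆` across the agents (`C̆_m` partitions `D_m` and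
`∑_m C̆_m^k = P̆^k`). -/
theorem stmt17 {p K M : ℕ} (hK2 : 2 ≤ K) (hM : 0 < M)
    (Dm : Fin M → Multiset (EuclideanSpace ℝ (Fin p)))
    (D : Multiset (EuclideanSpace ℝ (Fin p))) (hD : ∑ m, Dm m = D)
    (hdistinct : HasKDistinct K D) :
    (∀ (x : Fin M → Fin K → EuclideanSpace ℝ (Fin p))
        (C : Fin M → Fin K → Multiset (EuclideanSpace ℝ (Fin p))),
      (∀ m, IsKPartition (Dm m) (C m)) →
      (∀ m m', x m = x m') →
      (∀ (x' : Fin M → Fin K → EuclideanSpace ℝ (Fin p))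
          (C' : Fin M → Fin K → Multiset (EuclideanSpace ℝ (Fin p))),
        (∀ m, IsKPartition (Dm m) (C' m)) → (∀ m m', x' m = x' m') →
        (∑ m, ∑ k, ((C m k).map fun y => ‖y - x m k‖ ^ 2).sum) ≤
          ∑ m, ∑ k, ((C' m k).map fun y => ‖y - x' m k‖ ^ 2).sum) →
      ∀ m₀ : Fin M,
        IsKPartition D (fun k => ∑ m, C m k) ∧
        ∀ (x'' : Fin K → EuclideanSpace ℝ (Fin p))
            (P'' : Fin K → Multiset (EuclideanSpace ℝ (Fin p))),
          IsKPartition D P'' →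
          costH (x m₀) (fun k => ∑ m, C m k) ≤ costH x'' P'') ∧
    (∀ (z : Fin K → EuclideanSpace ℝ (Fin p))
        (P : Fin K → Multiset (EuclideanSpace ℝ (Fin p))),
      IsKPartition D P →
      (∀ (z' : Fin K → EuclideanSpace ℝ (Fin p))
          (P' : Fin K → Multiset (EuclideanSpace ℝ (Fin p))),
        IsKPartition D P' → costH z P ≤ costH z' P') →
      ∀ C : Fin M → Fin K → Multiset (EuclideanSpace ℝ (Fin p)),
        (∀ m, IsKPartition (Dm m) (C m)) → (∀ k, ∑ m, C m k = P k) →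
        ∀ (x' : Fin M → Fin K → EuclideanSpace ℝ (Fin p))
          (C' : Fin M → Fin K → Multiset (EuclideanSpace ℝ (Fin p))),
          (∀ m, IsKPartition (Dm m) (C' m)) → (∀ m m', x' m = x' m') →
          (∑ m, ∑ k, ((C m k).map fun y => ‖y - z k‖ ^ 2).sum) ≤
            ∑ m, ∑ k, ((C' m k).map fun y => ‖y - x' m k‖ ^ 2).sum) := by
  subst hD
  constructor
  · intro x C hC hx hmin m₀
    refine ⟨isKPartition_sum hC, fun x'' P'' hP'' => ?_⟩
    have : Nonempty (Fin K) := ⟨⟨0, by omega⟩⟩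
    choose f hf using fun y => Finite.exists_min fun k => ‖y - x'' k‖ ^ 2
    have hV := fun m => isKPartition_filter f (Dm m)
    calc costH (x m₀) (fun k => ∑ m, C m k) = ∑ m, costH (x m) (C m) := by
          rw [costH_sum]
          exact Finset.sum_congr rfl fun m _ => by rw [hx m₀ m]
      _ ≤ ∑ m, costH x'' (fun k => (Dm m).filter fun y => f y = k) :=
          hmin (fun _ => x'') _ hV fun _ _ => rfl
      _ = costH x'' (fun k => ∑ m, (Dm m).filter fun y => f y = k) :=
          (costH_sum x'' fun m k => (Dm m).filter fun y => f y = k).symm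
      _ ≤ costH x'' P'' := by
          refine costH_nearest_le hf (isKPartition_sum hV) hP'' fun k y hy => ?_
          obtain ⟨m, -, hm⟩ := Multiset.mem_sum.1 hy
          exact (Multiset.mem_filter.1 hm).2
  · intro z P hP hmin C hC hCP x' C' hC' hx'
    obtain rfl : (fun k => ∑ m, C m k) = P := funext hCP
    calc ∑ m, costH z (C m) = costH z (fun k => ∑ m, C m k) := (costH_sum z C).symm
      _ ≤ costH (x' ⟨0, hM⟩) (fun k => ∑ m, C' m k) := hmin _ _ (isKPartition_sum hC')
      _ = ∑ m, costH (x' m) (C' m) := by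
          rw [costH_sum]
          exact Finset.sum_congr rfl fun m _ => by rw [hx' ⟨0, hM⟩ m]
end
end

section
/- Let the dataset contain at least K distinct points and the communication graph be connected. Fix ρ > 0 and let x̆ ∈ M̄^ρ (a generalized Lloyd's minimum with all centers in the closed convex hull of D). Then for every k ∈ {1,…,K} and every pair of agents (m,l) ∈ {1,…,M}², the cluster centers satisfy ‖x̆_m^k − x̆_l^k‖ ≤ 4√M R₀ |D| / (ρ λ₂(L)), where R₀ = max{‖v‖ : v ∈ closed convex hull of D} and λ₂(L) > 0 is the second-smallest eigenvalue of the graph Laplacian L. -/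
open scoped BigOperators

noncomputable section

open scoped Matrix

/-- A multiset of vectors of norm at most `R` has a sum of norm at most `card * R`. -/
lemma Multiset.norm_sum_le_card_mul {E : Type*} [SeminormedAddCommGroup E] {R : ℝ}
    (s : Multiset E) (h : ∀ y ∈ s, ‖y‖ ≤ R) : ‖s.sum‖ ≤ s.card * R := by
  induction s using Multiset.induction_on with
  | empty => simp
  | cons a s ih =>
    rw [Multiset.sum_cons, Multiset.card_cons]
    have h₁ := h a (Multiset.mem_cons_self a s)
    have h₂ := ih fun y hy => h y (Multiset.mem_cons_of_mem hy)
    push_cast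
    linarith [norm_add_le a s.sum]

/-- The Euclidean norm is at most the `ℓ¹` norm. -/
lemma EuclideanSpace.norm_le_sum_abs {ι : Type*} [Fintype ι] (v : EuclideanSpace ℝ ι) :
    ‖v‖ ≤ ∑ i, |v i| := by
  have h := Finset.sum_sq_le_sq_sum_of_nonneg (s := Finset.univ) (f := fun i => |v i|)
    (fun i _ => abs_nonneg _)
  rw [EuclideanSpace.norm_eq]
  refine Real.sqrt_le_iff.mpr ⟨Finset.sum_nonneg fun i _ => abs_nonneg _, ?_⟩
  simpa using h

section Laplacian

variable {M : ℕ} (G : SimpleGraph (Fin M)) [DecidableRel G.Adj]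

lemma nonneg_of_mem_spectrum_lapMatrix {μ : ℝ} (hμ : μ ∈ spectrum ℝ (G.lapMatrix ℝ)) : 0 ≤ μ := by
  have hpsd := SimpleGraph.posSemidef_lapMatrix ℝ G
  rw [hpsd.isHermitian.spectrum_real_eq_range_eigenvalues] at hμ
  obtain ⟨i, rfl⟩ := hμ
  exact hpsd.eigenvalues_nonneg i

/-- The nonzero spectrum of the graph Laplacian is bounded below by `lapLam2`. -/
lemma lapLam2_le {μ : ℝ} (hμ : μ ∈ spectrum ℝ (G.lapMatrix ℝ)) (h0 : μ ≠ 0) :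
    lapLam2 G ≤ μ :=
  csInf_le (Matrix.finite_real_spectrum.subset fun _ h => h.1).bddBelow ⟨hμ, h0⟩

lemma lapLam2_pos {μ : ℝ} (hμ : μ ∈ spectrum ℝ (G.lapMatrix ℝ)) (h0 : μ ≠ 0) :
    0 < lapLam2 G := by
  have hmem : lapLam2 G ∈ {μ : ℝ | μ ∈ spectrum ℝ (G.lapMatrix ℝ) ∧ μ ≠ 0} :=
    Set.Nonempty.csInf_mem ⟨μ, hμ, h0⟩ (Matrix.finite_real_spectrum.subset fun _ h => h.1)
  exact lt_of_le_of_ne (nonneg_of_mem_spectrum_lapMatrix G hmem.1) (Ne.symm hmem.2)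

variable {G}

/-- On a connected graph, eigenvectors of the Laplacian for the eigenvalue zero are constant. -/
lemma eigenvectorBasis_apply_eq_of_eigenvalue_eq_zero (hconn : G.Connected)
    (hA : (G.lapMatrix ℝ).IsHermitian) {i : Fin M} (hi : hA.eigenvalues i = 0) (m l : Fin M) :
    hA.eigenvectorBasis i m = hA.eigenvectorBasis i l := by
  have h := hA.mulVec_eigenvectorBasis i
  rw [hi, zero_smul] at h
  exact G.lapMatrix_mulVec_eq_zero_iff_forall_reachable.mp h m l (hconn.preconnected m l)

lemma sub_eq_sum_eigenvectorBasis (hA : (G.lapMatrix ℝ).IsHermitian) (u : Fin M → ℝ)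
    (m l : Fin M) :
    u m - u l = ∑ i, (hA.eigenvectorBasis i m - hA.eigenvectorBasis i l) *
      inner ℝ (hA.eigenvectorBasis i) (WithLp.toLp 2 u) := by
  have h := hA.eigenvectorBasis.sum_inner_mul_inner
    (EuclideanSpace.single m (1 : ℝ) - EuclideanSpace.single l 1) (WithLp.toLp 2 u)
  simpa [inner_sub_left, EuclideanSpace.inner_single_left] using h.symm

lemma inner_eigenvectorBasis_lapMatrix_mulVec (hA : (G.lapMatrix ℝ).IsHermitian)
    (u : Fin M → ℝ) (i : Fin M) :
    inner ℝ (hA.eigenvectorBasis i) (WithLp.toLp 2 (G.lapMatrix ℝ *ᵥ u)) =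
      hA.eigenvalues i * inner ℝ (hA.eigenvectorBasis i) (WithLp.toLp 2 u) := by
  have h := hA.mulVec_eigenvectorBasis i
  simp only [EuclideanSpace.inner_eq_star_dotProduct, star_trivial]
  rw [dotProduct_comm, Matrix.dotProduct_mulVec, ← Matrix.mulVec_transpose,
    (G.isSymm_lapMatrix (R := ℝ)).eq, h, smul_dotProduct, smul_eq_mul, dotProduct_comm]

/-- If some function on the vertices of a connected graph is not constant, then the Laplacian has
a nonzero eigenvalue. -/
lemma exists_spectrum_ne_zero_of_ne (hconn : G.Connected) {u : Fin M → ℝ} {m l : Fin M}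
    (h : u m ≠ u l) : ∃ μ ∈ spectrum ℝ (G.lapMatrix ℝ), μ ≠ 0 := by
  by_contra! hall
  have hA := G.isHermitian_lapMatrix (R := ℝ)
  refine h (sub_eq_zero.mp ?_)
  rw [sub_eq_sum_eigenvectorBasis hA u m l]
  refine Finset.sum_eq_zero fun i _ => ?_
  rw [eigenvectorBasis_apply_eq_of_eigenvalue_eq_zero hconn hA
    (hall _ (hA.eigenvalues_mem_spectrum_real i)) m l, sub_self, zero_mul]

/-- The spread of a function on a connected graph is controlled by the `ℓ¹` norm of its
Laplacian. -/
lemma lapLam2_mul_sub_le (hconn : G.Connected) (u : Fin M → ℝ) (m l : Fin M) :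
    lapLam2 G * (u m - u l) ≤ 2 * ∑ j, |(G.lapMatrix ℝ *ᵥ u) j| := by
  have hpsd := SimpleGraph.posSemidef_lapMatrix ℝ G
  have hA := hpsd.isHermitian
  set b := hA.eigenvectorBasis with hb
  set w : EuclideanSpace ℝ (Fin M) :=
    EuclideanSpace.single m (1 : ℝ) - EuclideanSpace.single l 1 with hw
  set h : EuclideanSpace ℝ (Fin M) := WithLp.toLp 2 (G.lapMatrix ℝ *ᵥ u) with hh
  have hwb : ∀ i, inner ℝ (b i) w = b i m - b i l := fun i => by
    simp [hw, inner_sub_right, EuclideanSpace.inner_single_right]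
  have hterm : ∀ i, lapLam2 G * ((b i m - b i l) * inner ℝ (b i) (WithLp.toLp 2 u)) ≤
      |inner ℝ (b i) w| * |inner ℝ (b i) h| := fun i => by
    by_cases hi : hA.eigenvalues i = 0
    · rw [eigenvectorBasis_apply_eq_of_eigenvalue_eq_zero hconn hA hi m l, sub_self, zero_mul,
        mul_zero]
      positivity
    · have hmem := hA.eigenvalues_mem_spectrum_real i
      have hle := lapLam2_le G hmem hi
      have hpos := lapLam2_pos G hmem hi
      rw [hh, inner_eigenvectorBasis_lapMatrix_mulVec hA u i, hwb i, abs_mul,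
        abs_of_nonneg (hpsd.eigenvalues_nonneg i)]
      calc lapLam2 G * ((b i m - b i l) * inner ℝ (b i) (WithLp.toLp 2 u))
          ≤ lapLam2 G * |(b i m - b i l) * inner ℝ (b i) (WithLp.toLp 2 u)| := by
            gcongr; exact le_abs_self _
        _ ≤ hA.eigenvalues i * |(b i m - b i l) * inner ℝ (b i) (WithLp.toLp 2 u)| := by gcongr
        _ = |b i m - b i l| * (hA.eigenvalues i * |inner ℝ (b i) (WithLp.toLp 2 u)|) := by
            rw [abs_mul]; ring
  have hw2 : ‖w‖ ≤ 2 := by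
    refine (norm_sub_le _ _).trans ?_
    simp only [PiLp.norm_single, norm_one]
    norm_num
  calc lapLam2 G * (u m - u l)
      = ∑ i, lapLam2 G * ((b i m - b i l) * inner ℝ (b i) (WithLp.toLp 2 u)) := by
        rw [sub_eq_sum_eigenvectorBasis hA u m l, Finset.mul_sum]
    _ ≤ ∑ i, |inner ℝ (b i) w| * |inner ℝ (b i) h| := Finset.sum_le_sum fun i _ => hterm i
    _ ≤ √(∑ i, |inner ℝ (b i) w| ^ 2) * √(∑ i, |inner ℝ (b i) h| ^ 2) :=
        Real.sum_mul_le_sqrt_mul_sqrt _ _ _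
    _ = ‖w‖ * ‖h‖ := by
        simp only [sq_abs, b.sum_sq_inner_right, Real.sqrt_sq (norm_nonneg _)]
    _ ≤ 2 * ∑ j, |(G.lapMatrix ℝ *ᵥ u) j| := by
        gcongr
        exact EuclideanSpace.norm_le_sum_abs h

end Laplacian

lemma norm_le_R0 {p : ℕ} {D : Multiset (EuclideanSpace ℝ (Fin p))}
    {v : EuclideanSpace ℝ (Fin p)} (hv : v ∈ convexHull ℝ {y | y ∈ D}) : ‖v‖ ≤ R0 D := by
  have hfin : {y | y ∈ D}.Finite := Multiset.finite_toSet D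
  exact le_csSup ((hfin.isCompact_convexHull ℝ).image continuous_norm).bddAbove ⟨v, hv, rfl⟩

/-- At a fixed point of the center equations, the Laplacian of the inner products of the
centers with a vector `d` is given by the local deviations of the clusters. -/
lemma IsFixedCenters.lapMatrix_mulVec_inner {p K M : ℕ} {ρ : ℝ} {G : SimpleGraph (Fin M)}
    [DecidableRel G.Adj] {x : Fin M → Fin K → EuclideanSpace ℝ (Fin p)}
    {C : Fin M → Fin K → Multiset (EuclideanSpace ℝ (Fin p))} (hfix : IsFixedCenters ρ G x C)
    (k : Fin K) (d : EuclideanSpace ℝ (Fin p)) (j : Fin M) :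
    (G.lapMatrix ℝ *ᵥ fun m => inner ℝ (x m k) d) j =
      1 / ρ * inner ℝ ((C j k).sum - ((C j k).card : ℝ) • x j k) d := by
  have h := congrArg (fun v => inner ℝ v d) (hfix j k)
  simp only [inner_add_left, sum_inner, real_inner_smul_left] at h
  rw [SimpleGraph.lapMatrix_mulVec_apply, inner_sub_left, real_inner_smul_left]
  linarith

/-- Lemma 8: at any `x̆ ∈ M̄^ρ`, the deviation from consensus obeys
`‖x̆_m^k − x̆_l^k‖ ≤ 4√M R₀ |D| / (ρ λ₂(L))`. -/
theorem stmt18 {p K M : ℕ} (hK2 : 2 ≤ K)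
    (Dm : Fin M → Multiset (EuclideanSpace ℝ (Fin p)))
    (D : Multiset (EuclideanSpace ℝ (Fin p))) (hD : ∑ m, Dm m = D)
    (hdistinct : HasKDistinct K D)
    (G : SimpleGraph (Fin M)) [DecidableRel G.Adj] (hconn : G.Connected)
    (ρ : ℝ) (hρ : 0 < ρ)
    (x : Fin M → Fin K → EuclideanSpace ℝ (Fin p))
    (hx : x ∈ genMbar ρ G Dm D K) :
    ∀ (k : Fin K) (m l : Fin M),
      ‖x m k - x l k‖ ≤ 4 * Real.sqrt M * R0 D * (Multiset.card D : ℝ) /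
        (ρ * lapLam2 G) := by
  intro k m l
  obtain ⟨⟨C, ⟨hpart, -⟩, hfix⟩, hhull⟩ := hx
  have hR : 0 ≤ R0 D := (norm_nonneg _).trans (norm_le_R0 (hhull m k))
  set d := x m k - x l k with hd
  rcases eq_or_ne d 0 with h0 | h0
  · have hlam : 0 ≤ lapLam2 G := Real.sInf_nonneg fun μ hμ =>
      nonneg_of_mem_spectrum_lapMatrix G hμ.1
    rw [h0, norm_zero]
    positivity
  have hdpos : 0 < ‖d‖ := norm_pos_iff.mpr h0
  have hdd : inner ℝ (x m k) d - inner ℝ (x l k) d = ‖d‖ ^ 2 := by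
    rw [← inner_sub_left, ← hd, real_inner_self_eq_norm_sq]
  have hlam : 0 < lapLam2 G := by
    obtain ⟨μ, hμ, hμ0⟩ := exists_spectrum_ne_zero_of_ne hconn
      (u := fun j => inner ℝ (x j k) d) (m := m) (l := l)
      (sub_ne_zero.mp (by rw [hdd]; positivity))
    exact lapLam2_pos G hμ hμ0
  have hmemD : ∀ j y, y ∈ C j k → y ∈ D := fun j y hy => by
    have hCD : C j k ≤ Dm j := by
      rw [← hpart j]
      exact Finset.single_le_sum (f := C j) (fun _ _ => Multiset.zero_le _) (Finset.mem_univ k)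
    have hDD : Dm j ≤ D := by
      rw [← hD]
      exact Finset.single_le_sum (f := Dm) (fun _ _ => Multiset.zero_le _) (Finset.mem_univ j)
    exact Multiset.mem_of_le (hCD.trans hDD) hy
  have hcard : ∑ j, ((C j k).card : ℝ) ≤ (D.card : ℝ) := by
    have : ∑ j, (C j k).card ≤ D.card := by
      rw [← hD, Multiset.card_sum]
      refine Finset.sum_le_sum fun j _ => Multiset.card_le_card ?_
      rw [← hpart j]
      exact Finset.single_le_sum (f := C j) (fun _ _ => Multiset.zero_le _) (Finset.mem_univ k)
    exact_mod_cast this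
  have hg : ∀ j, ‖(C j k).sum - ((C j k).card : ℝ) • x j k‖ ≤ (C j k).card * (2 * R0 D) :=
    fun j => by
      have h₁ := (C j k).norm_sum_le_card_mul fun y hy =>
        norm_le_R0 (subset_convexHull ℝ {y | y ∈ D} (hmemD j y hy))
      have h₂ : ‖((C j k).card : ℝ) • x j k‖ ≤ (C j k).card * R0 D := by
        rw [norm_smul, Real.norm_natCast]
        gcongr
        exact norm_le_R0 (hhull j k)
      linarith [norm_sub_le (C j k).sum (((C j k).card : ℝ) • x j k)]
  have hsum : ∑ j, |(G.lapMatrix ℝ *ᵥ fun m => inner ℝ (x m k) d) j| ≤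
      1 / ρ * (D.card * (2 * R0 D) * ‖d‖) := by
    calc _ ≤ ∑ j, 1 / ρ * ((C j k).card * (2 * R0 D) * ‖d‖) := by
          refine Finset.sum_le_sum fun j _ => ?_
          rw [hfix.lapMatrix_mulVec_inner, abs_mul, abs_of_pos (by positivity)]
          gcongr
          exact (abs_real_inner_le_norm _ _).trans (by gcongr; exact hg j)
      _ = 1 / ρ * ((∑ j, ((C j k).card : ℝ)) * (2 * R0 D) * ‖d‖) := by
          rw [Finset.sum_mul, Finset.sum_mul, Finset.mul_sum]
      _ ≤ _ := by gcongr
  have hmain := lapLam2_mul_sub_le hconn (fun j => inner ℝ (x j k) d) m l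
  rw [hdd] at hmain
  have hbound : ρ * lapLam2 G * ‖d‖ ≤ 4 * R0 D * D.card := by
    refine le_of_mul_le_mul_right ?_ hdpos
    calc ρ * lapLam2 G * ‖d‖ * ‖d‖ = ρ * (lapLam2 G * ‖d‖ ^ 2) := by ring
      _ ≤ ρ * (2 * (1 / ρ * (D.card * (2 * R0 D) * ‖d‖))) := by
          refine mul_le_mul_of_nonneg_left (hmain.trans ?_) hρ.le
          gcongr
      _ = 4 * R0 D * D.card * ‖d‖ := by field_simp; ring
  have hM : 1 ≤ √(M : ℝ) := Real.one_le_sqrt.mpr (by exact_mod_cast m.pos)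
  rw [le_div_iff₀ (by positivity)]
  calc ‖d‖ * (ρ * lapLam2 G) ≤ 1 * (4 * R0 D * D.card) := by linarith
    _ ≤ √(M : ℝ) * (4 * R0 D * D.card) := by gcongr
    _ = _ := by ring
end
end
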